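/- Let 2 < p < ∞ and let Q : L^p(𝕋) → L^p(𝕋) be the lacunary projection defined on trigonometric polynomials by Q(∑_n c_n γ^n) = ∑_{m≥1} c_{2^m} γ^{2^m}. Then Q extends to a bounded operator on L^p(𝕋), and there is a constant C_p such that for every f ∈ L^p(𝕋) with Fourier coefficients (c_n), (1/C_p)(∑_{m≥1} |c_{2^m}|²)^{1/2} ≤ ‖Qf‖_p ≤ C_p (∑_{m≥1} |c_{2^m}|²)^{1/2}. -/

import Mathlib

open MeasureTheory Filter Asymptotics Finset

set_option maxHeartbeats 1000000
set_option synthInstance.maxHeartbeats 400000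

instance : Fact (0 < 2 * Real.pi) := ⟨by positivity⟩

open AddCircle

/-- The number of ordered representations of `n` as a sum of `k` powers of two is bounded
in terms of `k` alone. -/
theorem exists_card_sum_two_pow_le (k : ℕ) :
    ∃ R : ℕ, ∀ (s : Finset ℕ) (n : ℕ),
      #{t ∈ Fintype.piFinset (fun _ : Fin k => s) | ∑ i, 2 ^ t i = n} ≤ R := by
  induction k with
  | zero =>
    refine ⟨1, fun s n => (card_filter_le _ _).trans ?_⟩
    simp
  | succ k ih =>
    obtain ⟨R, hR⟩ := ih
    refine ⟨(k + 1) * (k + 1) * R, fun s n => ?_⟩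
    have hfib : ∀ (i : Fin (k + 1)) (m : ℕ),
        #{t ∈ Fintype.piFinset (fun _ : Fin (k + 1) => s) | t i = m ∧ ∑ j, 2 ^ t j = n} ≤ R := by
      intro i m
      refine (card_le_card_of_injOn (Fin.removeNth i) ?_ ?_).trans (hR s (n - 2 ^ m))
      · intro t ht
        simp only [coe_filter, Fintype.mem_piFinset, Set.mem_ofPred_eq] at ht ⊢
        obtain ⟨hts, rfl, hsum⟩ := ht
        refine ⟨fun j => hts _, ?_⟩
        rw [Fin.sum_univ_succAbove _ i] at hsum
        simp only [Fin.removeNth_apply]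
        omega
      · intro t ht u hu htu
        simp only [coe_filter, Set.mem_ofPred_eq] at ht hu
        rw [← Fin.insertNth_self_removeNth i t, ← Fin.insertNth_self_removeNth i u, htu,
          ht.2.1, hu.2.1]
    calc #{t ∈ Fintype.piFinset (fun _ : Fin (k + 1) => s) | ∑ i, 2 ^ t i = n}
        ≤ #((univ ×ˢ range (k + 1) : Finset (Fin (k + 1) × ℕ)).biUnion fun q =>
            {t ∈ Fintype.piFinset (fun _ : Fin (k + 1) => s) |
              t q.1 = Nat.log 2 n - q.2 ∧ ∑ j, 2 ^ t j = n}) := by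
          refine card_le_card fun t ht => ?_
          obtain ⟨hts, hsum⟩ := mem_filter.1 ht
          obtain ⟨i, -, hi⟩ := exists_max_image univ t univ_nonempty
          have hle : 2 ^ t i ≤ n :=
            hsum ▸ single_le_sum (f := fun j => 2 ^ t j) (fun _ _ => Nat.zero_le _) (mem_univ i)
          have hn : n ≠ 0 := (Nat.two_pow_pos _).trans_le hle |>.ne'
          have hge : n ≤ (k + 1) * 2 ^ t i := by
            rw [← hsum]
            refine (sum_le_card_nsmul univ _ (2 ^ t i) fun j hj => ?_).trans_eq (by simp)
            exact Nat.pow_le_pow_right two_pos (hi j hj)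
          have hlt : n < 2 ^ (k + 1 + t i) := by
            rw [pow_add]
            refine hge.trans_lt ?_
            gcongr
            exact Nat.lt_two_pow_self
          have h1 : t i ≤ Nat.log 2 n := Nat.le_log_of_pow_le one_lt_two hle
          have h2 : Nat.log 2 n < k + 1 + t i := Nat.log_lt_of_lt_pow hn hlt
          simp only [mem_biUnion, mem_product, mem_univ, true_and, mem_range, mem_filter]
          exact ⟨(i, Nat.log 2 n - t i), by dsimp only; omega, hts, by dsimp only; omega, hsum⟩
      _ ≤ #(univ ×ˢ range (k + 1) : Finset (Fin (k + 1) × ℕ)) * R :=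
          card_biUnion_le_card_mul _ _ _ fun q _ => hfib q.1 _
      _ = (k + 1) * (k + 1) * R := by simp

theorem integral_fourier_mul_conj_fourier {T : ℝ} [Fact (0 < T)] (m n : ℤ) :
    ∫ x : AddCircle T, fourier m x * starRingEnd ℂ (fourier n x) ∂haarAddCircle =
      if m = n then 1 else 0 := by
  have h := congrFun (fourierCoeff_fourier (T := T) m) n
  simp only [fourierCoeff, smul_eq_mul, fourier_neg] at h
  simp_rw [mul_comm (fourier m _), h, Pi.single_apply, eq_comm]

/-- A trigonometric sum in which every frequency occurs at most `R` times satisfies Bessel's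
inequality up to the factor `R`. -/
theorem integral_norm_sq_sum_fourier_le {T : ℝ} [Fact (0 < T)] {ι : Type*}
    (s : Finset ι) (b : ι → ℂ) (φ : ι → ℤ) (R : ℕ) (hR : ∀ n, #{i ∈ s | φ i = n} ≤ R) :
    ∫ x : AddCircle T, ‖∑ i ∈ s, b i * fourier (φ i) x‖ ^ 2 ∂haarAddCircle ≤
      R * ∑ i ∈ s, ‖b i‖ ^ 2 := by
  have h1 : ((∫ x : AddCircle T, ‖∑ i ∈ s, b i * fourier (φ i) x‖ ^ 2 ∂haarAddCircle : ℝ) : ℂ) =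
      ∑ i ∈ s, ∑ j ∈ s, b i * starRingEnd ℂ (b j) * if φ i = φ j then 1 else 0 := by
    have hexp : ∀ x : AddCircle T, ((‖∑ i ∈ s, b i * fourier (φ i) x‖ ^ 2 : ℝ) : ℂ) =
        ∑ i ∈ s, ∑ j ∈ s, b i * starRingEnd ℂ (b j) *
          (fourier (φ i) x * starRingEnd ℂ (fourier (φ j) x)) := by
      intro x
      push_cast
      rw [← Complex.mul_conj', map_sum, sum_mul_sum]
      refine sum_congr rfl fun i _ => sum_congr rfl fun j _ => ?_
      rw [map_mul]
      ring
    have hint : ∀ i j, Integrable (fun x : AddCircle T => b i * starRingEnd ℂ (b j) *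
        (fourier (φ i) x * starRingEnd ℂ (fourier (φ j) x))) haarAddCircle := fun i j =>
      Continuous.integrable_of_hasCompactSupport (by fun_prop) (HasCompactSupport.of_compactSpace _)
    rw [← integral_complex_ofReal]
    simp_rw [hexp]
    rw [integral_finsetSum _ fun i _ => integrable_finsetSum _ fun j _ => hint i j]
    refine sum_congr rfl fun i _ => ?_
    rw [integral_finsetSum _ fun j _ => hint i j]
    refine sum_congr rfl fun j _ => ?_
    rw [integral_const_mul, integral_fourier_mul_conj_fourier]
  have hdiag : ∑ i ∈ s, ∑ j ∈ s, (if φ j = φ i then ‖b i‖ ^ 2 else 0) ≤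
      R * ∑ i ∈ s, ‖b i‖ ^ 2 := by
    rw [mul_sum]
    refine sum_le_sum fun i _ => ?_
    rw [← sum_filter, sum_const, nsmul_eq_mul]
    gcongr
    exact hR _
  have hdiag' : ∑ i ∈ s, ∑ j ∈ s, (if φ j = φ i then ‖b j‖ ^ 2 else 0) ≤
      R * ∑ i ∈ s, ‖b i‖ ^ 2 := by
    rw [sum_comm]
    simpa only [eq_comm] using hdiag
  calc ∫ x : AddCircle T, ‖∑ i ∈ s, b i * fourier (φ i) x‖ ^ 2 ∂haarAddCircle
      ≤ ‖∑ i ∈ s, ∑ j ∈ s, b i * starRingEnd ℂ (b j) * if φ i = φ j then 1 else 0‖ := by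
        rw [← h1, Complex.norm_real]
        exact le_abs_self _
    _ ≤ ∑ i ∈ s, ∑ j ∈ s, ((if φ j = φ i then ‖b i‖ ^ 2 else 0) +
          (if φ j = φ i then ‖b j‖ ^ 2 else 0)) / 2 := by
        refine norm_sum_le_of_le _ fun i _ => norm_sum_le_of_le _ fun j _ => ?_
        by_cases h : φ i = φ j
        · simp only [h, if_true, mul_one, norm_mul, RCLike.norm_conj]
          nlinarith [sq_nonneg (‖b i‖ - ‖b j‖)]
        · simp [h, Ne.symm h]
    _ ≤ R * ∑ i ∈ s, ‖b i‖ ^ 2 := by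
        simp_rw [← sum_div, sum_add_distrib]
        linarith

theorem fourier_sum {T : ℝ} {ι : Type*} (s : Finset ι) (φ : ι → ℤ) (x : AddCircle T) :
    fourier (∑ i ∈ s, φ i) x = ∏ i ∈ s, fourier (φ i) x := by
  induction s using Finset.cons_induction with
  | empty => simp
  | cons i s hi ih => rw [sum_cons, prod_cons, fourier_add, ih]

theorem exists_integral_norm_pow_lacunary_le {T : ℝ} [Fact (0 < T)] (k : ℕ) :
    ∃ R : ℕ, ∀ (s : Finset ℕ) (a : ℕ → ℂ),
      ∫ x : AddCircle T, ‖∑ m ∈ s, a m * fourier (2 ^ m) x‖ ^ (2 * k) ∂haarAddCircle ≤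
        R * (∑ m ∈ s, ‖a m‖ ^ 2) ^ k := by
  obtain ⟨R, hR⟩ := exists_card_sum_two_pow_le k
  refine ⟨R, fun s a => ?_⟩
  have h := integral_norm_sq_sum_fourier_le (T := T) (Fintype.piFinset fun _ : Fin k => s)
    (fun t => ∏ i, a (t i)) (fun t => ∑ i, 2 ^ t i) R ?_
  · have hpow : ∀ x : AddCircle T, ‖∑ m ∈ s, a m * fourier (2 ^ m) x‖ ^ (2 * k) =
        ‖∑ t ∈ Fintype.piFinset fun _ : Fin k => s,
          (∏ i, a (t i)) * fourier (∑ i, 2 ^ t i) x‖ ^ 2 := by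
      intro x
      rw [mul_comm 2 k, pow_mul, ← norm_pow, sum_pow']
      simp_rw [fourier_sum, ← prod_mul_distrib]
    simp_rw [hpow]
    refine h.trans_eq ?_
    rw [sum_pow']
    simp_rw [norm_prod, prod_pow]
  · intro n
    by_cases hn : 0 ≤ n
    · lift n to ℕ using hn
      exact_mod_cast hR s n
    · rw [filter_false_of_mem]
      · simp
      · intro t _ ht
        exact hn (ht ▸ by positivity)

/-- On finite lacunary sums with frequencies `2 ^ m` the `L^p` norm is controlled by the `ℓ²` norm
of the coefficients. -/
theorem exists_norm_lacunary_sum_le {T : ℝ} [Fact (0 < T)] {p : ENNReal} [Fact (1 ≤ p)]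
    (hp : p ≠ ⊤) :
    ∃ C : ℝ, 1 ≤ C ∧ ∀ (s : Finset ℕ) (a : ℕ → ℂ),
      ‖∑ m ∈ s, a m • fourierLp (T := T) p (2 ^ m)‖ ≤ C * √(∑ m ∈ s, ‖a m‖ ^ 2) := by
  obtain ⟨k, hk⟩ := exists_nat_ge p.toReal
  have hp1 : 1 ≤ p.toReal := by
    simpa using ENNReal.toReal_mono hp (Fact.out : (1 : ENNReal) ≤ p)
  have hk0 : 0 < k := by exact_mod_cast zero_lt_one.trans_le (hp1.trans hk)
  have hpk : p ≤ (2 * k : ℕ) := by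
    rw [← ENNReal.ofReal_toReal hp, ← ENNReal.ofReal_natCast]
    apply ENNReal.ofReal_le_ofReal
    push_cast
    linarith
  obtain ⟨R, hR⟩ := exists_integral_norm_pow_lacunary_le (T := T) k
  have hR1 : (1 : ℝ) ≤ R + 1 := by linarith [R.cast_nonneg (α := ℝ)]
  refine ⟨R + 1, hR1, fun s a => ?_⟩
  set S := ∑ m ∈ s, ‖a m‖ ^ 2 with hS
  have hS0 : 0 ≤ S := sum_nonneg fun _ _ => by positivity
  set g : C(AddCircle T, ℂ) := ∑ m ∈ s, a m • fourier (2 ^ m) with hg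
  have hgx : ∀ x, g x = ∑ m ∈ s, a m * fourier (2 ^ m) x := fun x => by
    simp [hg, ContinuousMap.sum_apply]
  have hsum : ∑ m ∈ s, a m • fourierLp (T := T) p (2 ^ m) =
      ContinuousMap.toLp (E := ℂ) p haarAddCircle ℂ g := by
    simp [hg, map_sum]
  have hint : ∫ x, ‖g x‖ ^ (2 * k) ∂haarAddCircle ≤ ((R + 1) * √S) ^ (2 * k) := by
    simp_rw [hgx]
    refine (hR s a).trans ?_
    rw [mul_pow, pow_mul √S, Real.sq_sqrt hS0]
    gcongr
    exact (le_add_of_nonneg_right zero_le_one).trans (le_self_pow₀ hR1 (by omega))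
  have hmem : MemLp g ((2 * k : ℕ) : ENNReal) haarAddCircle :=
    g.continuous.memLp_of_hasCompactSupport (HasCompactSupport.of_compactSpace _)
  have hk2 : ((2 * k : ℕ) : ENNReal) ≠ 0 := by exact_mod_cast (by omega : 2 * k ≠ 0)
  rw [hsum, Lp.norm_def, eLpNorm_congr_ae (ContinuousMap.coeFn_toLp _ _)]
  refine ENNReal.toReal_le_of_le_ofReal (by positivity) ?_
  refine (eLpNorm_le_eLpNorm_of_exponent_le hpk hmem.1).trans ?_
  rw [hmem.eLpNorm_eq_integral_rpow_norm hk2 (ENNReal.natCast_ne_top _)]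
  apply ENNReal.ofReal_le_ofReal
  simp only [ENNReal.toReal_natCast, Real.rpow_natCast]
  refine (Real.rpow_le_rpow (integral_nonneg fun x => by positivity) hint
    (by positivity)).trans_eq ?_
  exact Real.pow_rpow_inv_natCast (by positivity) (by omega)

theorem norm_fourierCoeff_le_norm_Lp {T : ℝ} [Fact (0 < T)] {p : ENNReal} [Fact (1 ≤ p)]
    (f : Lp ℂ p (haarAddCircle (T := T))) (n : ℤ) : ‖fourierCoeff f n‖ ≤ ‖f‖ := by
  have hf := Lp.memLp f
  calc ‖fourierCoeff f n‖ ≤ ∫ x, ‖f x‖ ∂haarAddCircle := by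
        refine (norm_integral_le_integral_norm _).trans_eq ?_
        simp_rw [norm_smul, fourier_apply, Circle.norm_coe, one_mul]
    _ = (eLpNorm f 1 haarAddCircle).toReal := by
        rw [integral_norm_eq_lintegral_enorm hf.1, eLpNorm_one_eq_lintegral_enorm]
    _ ≤ ‖f‖ := ENNReal.toReal_mono hf.2.ne (eLpNorm_le_eLpNorm_of_exponent_le Fact.out hf.1)

/-- The `n`-th Fourier coefficient as a continuous linear functional on `L^p`. -/
noncomputable def fourierCoeffLp {T : ℝ} [Fact (0 < T)] (p : ENNReal) [Fact (1 ≤ p)] (n : ℤ) :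
    Lp ℂ p (haarAddCircle (T := T)) →L[ℂ] ℂ :=
  LinearMap.mkContinuous
    { toFun := fun f => fourierCoeff f n
      map_add' := fun f g => by
        rw [fourierCoeff_congr_ae (Lp.coeFn_add f g),
          fourierCoeff.add ((Lp.memLp f).integrable Fact.out) ((Lp.memLp g).integrable Fact.out),
          Pi.add_apply]
      map_smul' := fun c f => by
        rw [fourierCoeff_congr_ae (Lp.coeFn_smul c f), fourierCoeff.const_smul, RingHom.id_apply] }
    1 fun f => by simpa using norm_fourierCoeff_le_norm_Lp f n

theorem fourierCoeffLp_apply {T : ℝ} [Fact (0 < T)] {p : ENNReal} [Fact (1 ≤ p)] (n : ℤ)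
    (f : Lp ℂ p (haarAddCircle (T := T))) : fourierCoeffLp p n f = fourierCoeff f n := rfl

theorem fourierCoeffLp_fourierLp {T : ℝ} [Fact (0 < T)] {p : ENNReal} [Fact (1 ≤ p)] (m n : ℤ) :
    fourierCoeffLp p n (fourierLp (T := T) p m) = if n = m then 1 else 0 := by
  rw [fourierCoeffLp_apply, fourierCoeff_congr_ae (coeFn_fourierLp p m), fourierCoeff_fourier,
    Pi.single_apply]

/-- Bessel's inequality for `f ∈ L^p`, `p ≥ 2`, along an injective family of frequencies. -/
theorem bessel_fourierCoeff_Lp {T : ℝ} [Fact (0 < T)] {p : ENNReal} [Fact (1 ≤ p)] (hp : 2 ≤ p)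
    {ι : Type*} {φ : ι → ℤ} (hφ : Function.Injective φ) (f : Lp ℂ p (haarAddCircle (T := T))) :
    Summable (fun i => ‖fourierCoeff f (φ i)‖ ^ 2) ∧
      √(∑' i, ‖fourierCoeff f (φ i)‖ ^ 2) ≤ ‖f‖ := by
  have hf := Lp.memLp f
  have hf2 : MemLp f 2 haarAddCircle := hf.mono_exponent hp
  have hcoeff : ∀ i, ‖fourierCoeff f (φ i)‖ ^ 2 =
      ‖inner ℂ (fourierLp (T := T) 2 (φ i)) (hf2.toLp f)‖ ^ 2 := by
    intro i
    rw [← coe_fourierBasis, ← HilbertBasis.repr_apply_apply, fourierBasis_repr,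
      fourierCoeff_congr_ae hf2.coeFn_toLp]
  have hon := (orthonormal_fourier (T := T)).comp φ hφ
  simp_rw [hcoeff]
  refine ⟨hon.inner_products_summable _, Real.sqrt_le_iff.2 ⟨norm_nonneg _, ?_⟩⟩
  refine (hon.tsum_inner_products_le _).trans ?_
  gcongr
  rw [Lp.norm_toLp, Lp.norm_def]
  exact ENNReal.toReal_mono hf.2.ne (eLpNorm_le_eLpNorm_of_exponent_le hp hf.1)

/-- An `ℓ²` bound on finite sums gives unconditional convergence and the same bound on the sum. -/
theorem summable_and_norm_tsum_le_of_sqrt_bound {E : Type*} [NormedAddCommGroup E]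
    [CompleteSpace E] {v : ℕ → E} {a : ℕ → ℂ} {C : ℝ} (hC : 0 < C)
    (h : ∀ s : Finset ℕ, ‖∑ m ∈ s, v m‖ ≤ C * √(∑ m ∈ s, ‖a m‖ ^ 2))
    (ha : Summable fun m => ‖a m‖ ^ 2) :
    Summable v ∧ ‖∑' m, v m‖ ≤ C * √(∑' m, ‖a m‖ ^ 2) := by
  have hs : Summable v := by
    rw [summable_iff_vanishing_norm]
    intro ε hε
    obtain ⟨s, hs⟩ := summable_iff_vanishing_norm.1 ha ((ε / C) ^ 2) (by positivity)
    refine ⟨s, fun t ht => (h t).trans_lt ?_⟩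
    rw [← lt_div_iff₀' hC, Real.sqrt_lt' (by positivity)]
    exact (le_abs_self _).trans_lt (hs t ht)
  refine ⟨hs, le_of_tendsto hs.hasSum.norm (Eventually.of_forall fun s => (h s).trans ?_)⟩
  gcongr
  exact ha.sum_le_tsum s fun _ _ => by positivity

theorem lacunary_projection_bounded_on_Lp
    (p : ℝ) (hp : 2 < p) [Fact (1 ≤ ENNReal.ofReal p)] :
    ∃ (Q : Lp ℂ (ENNReal.ofReal p) (@AddCircle.haarAddCircle (2 * Real.pi) _) →L[ℂ]
          Lp ℂ (ENNReal.ofReal p) (@AddCircle.haarAddCircle (2 * Real.pi) _))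
      (C : ℝ), 0 < C ∧
      ∀ f : Lp ℂ (ENNReal.ofReal p) (@AddCircle.haarAddCircle (2 * Real.pi) _),
        (∀ m : ℕ, 1 ≤ m →
          fourierCoeff (⇑(Q f) : AddCircle (2 * Real.pi) → ℂ) (2 ^ m) =
            fourierCoeff (⇑f : AddCircle (2 * Real.pi) → ℂ) (2 ^ m)) ∧
        (∀ n : ℤ, (∀ m : ℕ, 1 ≤ m → n ≠ 2 ^ m) →
          fourierCoeff (⇑(Q f) : AddCircle (2 * Real.pi) → ℂ) n = 0) ∧
        (1 / C) * Real.sqrt (∑' m : ℕ,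
            ‖fourierCoeff (⇑f : AddCircle (2 * Real.pi) → ℂ) (2 ^ (m + 1))‖ ^ 2) ≤
          ‖Q f‖ ∧
        ‖Q f‖ ≤ C * Real.sqrt (∑' m : ℕ,
            ‖fourierCoeff (⇑f : AddCircle (2 * Real.pi) → ℂ) (2 ^ (m + 1))‖ ^ 2) := by
  have hp2 : 2 ≤ ENNReal.ofReal p := by
    simpa using ENNReal.ofReal_le_ofReal hp.le
  obtain ⟨C, hC1, hC⟩ := exists_norm_lacunary_sum_le (T := 2 * Real.pi) (p := ENNReal.ofReal p)
    ENNReal.ofReal_ne_top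
  have hC0 : 0 < C := zero_lt_one.trans_le hC1
  have hinj : Function.Injective fun m : ℕ => (2 : ℤ) ^ (m + 1) := fun m n h => by
    simpa using pow_right_injective₀ (by norm_num : (0 : ℤ) < 2) (by norm_num) h
  have hbessel := bessel_fourierCoeff_Lp (T := 2 * Real.pi) hp2 hinj
  set v : Lp ℂ (ENNReal.ofReal p) (@haarAddCircle (2 * Real.pi) _) → ℕ →
      Lp ℂ (ENNReal.ofReal p) (@haarAddCircle (2 * Real.pi) _) := fun f m =>
    fourierCoeffLp _ (2 ^ (m + 1)) f • fourierLp _ (2 ^ (m + 1)) with hv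
  have hbound : ∀ f, Summable (v f) ∧
      ‖∑' m, v f m‖ ≤ C * √(∑' m, ‖fourierCoeff f (2 ^ (m + 1))‖ ^ 2) := fun f =>
    summable_and_norm_tsum_le_of_sqrt_bound hC0 (fun s => by
      simpa [hv, fourierCoeffLp_apply] using
        hC (s.map (addRightEmbedding 1)) fun m => fourierCoeffLp _ (2 ^ m) f) (hbessel f).1
  let Q : Lp ℂ (ENNReal.ofReal p) (@haarAddCircle (2 * Real.pi) _) →L[ℂ]
      Lp ℂ (ENNReal.ofReal p) (@haarAddCircle (2 * Real.pi) _) :=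
    LinearMap.mkContinuous
      { toFun := fun f => ∑' m, v f m
        map_add' := fun f g => by
          rw [← (hbound f).1.tsum_add (hbound g).1]
          simp [hv, add_smul]
        map_smul' := fun c f => by
          rw [RingHom.id_apply, ← (hbound f).1.tsum_const_smul c]
          simp [hv, mul_smul] }
      C fun f => (hbound f).2.trans (by gcongr; exact (hbessel f).2)
  have hcoeff : ∀ f n, fourierCoeff (Q f) n =
      ∑' m : ℕ, fourierCoeff f (2 ^ (m + 1)) * if n = 2 ^ (m + 1) then 1 else 0 := fun f n => by
    rw [← fourierCoeffLp_apply]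
    refine ((fourierCoeffLp _ n).map_tsum (hbound f).1).trans (tsum_congr fun m => ?_)
    rw [map_smul, fourierCoeffLp_fourierLp, fourierCoeffLp_apply, smul_eq_mul]
  have hpow : ∀ f (m : ℕ), 1 ≤ m → fourierCoeff (Q f) (2 ^ m) = fourierCoeff f (2 ^ m) := by
    intro f m hm
    obtain ⟨m, rfl⟩ := Nat.exists_eq_add_of_le' hm
    rw [hcoeff, tsum_eq_single m fun j hj => by rw [if_neg (hinj.ne hj.symm), mul_zero],
      if_pos rfl, mul_one]
  refine ⟨Q, C, hC0, fun f => ⟨hpow f, fun n hn => ?_, ?_, (hbound f).2⟩⟩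
  · rw [hcoeff]
    simp [fun m : ℕ => hn (m + 1) (by omega)]
  · have h := (hbessel (Q f)).2
    simp_rw [hpow f _ (Nat.le_add_left 1 _)] at h
    refine le_trans ?_ h
    exact mul_le_of_le_one_left (Real.sqrt_nonneg _) ((div_le_one hC0).2 hC1)
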